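/- For every character θ : T → k*, there is an isomorphism of kG-modules St ⊗_k M(θ) ≅ kG ⊗_{kT} k_θ, where the left-hand side carries the diagonal G-action and the right-hand side is the module induced from the one-dimensional kT-module k_θ. -/

import Mathlib

noncomputable section

open scoped TensorProduct

namespace SL2X

variable (p : ℕ) [Fact p.Prime]

/-- The algebraic closure of the prime field `𝔽_p`. -/
abbrev F : Type := AlgebraicClosure (ZMod p)

/-- `G = SL₂(F)`. -/
abbrev G : Type := Matrix.SpecialLinearGroup (Fin 2) (F p)

/-- The unipotent element `ε(x) = [[1,x],[0,1]]`. -/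
def eps (x : F p) : G p :=
  ⟨!![1, x; 0, 1], by simp [Matrix.det_fin_two_of]⟩

/-- The torus element `h(t) = diag(t, t⁻¹)`. -/
def h (t : (F p)ˣ) : G p :=
  ⟨!![(t : F p), 0; 0, ((t⁻¹ : (F p)ˣ) : F p)], by simp [Matrix.det_fin_two_of]⟩

/-- The Weyl element `s = [[0,1],[-1,0]]`. -/
def sG : G p :=
  ⟨!![0, 1; -1, 0], by simp [Matrix.det_fin_two_of]⟩

/-- The Borel subgroup `B` of upper triangular matrices in `G`. -/
def B : Subgroup (G p) where
  carrier := {g | (g : Matrix (Fin 2) (Fin 2) (F p)) 1 0 = 0}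
  one_mem' := by simp [Matrix.one_apply]
  mul_mem' := by
    intro a b ha hb
    simp only [Set.mem_setOf_eq] at *
    simp [Matrix.mul_apply, Fin.sum_univ_two, ha, hb]
  inv_mem' := by
    intro a ha
    simp only [Set.mem_setOf_eq] at *
    simp [Matrix.SpecialLinearGroup.coe_inv, Matrix.adjugate_fin_two, ha]

/-- The diagonal part of an element of `B`, as a unit of `F`. -/
def Bdiag (b : B p) : (F p)ˣ where
  val := ((b : G p) : Matrix (Fin 2) (Fin 2) (F p)) 0 0
  inv := ((b : G p) : Matrix (Fin 2) (Fin 2) (F p)) 1 1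
  val_inv := by
    have hdet : ((b : G p) : Matrix (Fin 2) (Fin 2) (F p)).det = 1 := (b : G p).2
    have h10 : ((b : G p) : Matrix (Fin 2) (Fin 2) (F p)) 1 0 = 0 := b.2
    rw [Matrix.det_fin_two, h10, mul_zero, sub_zero] at hdet
    exact hdet
  inv_val := by
    have hdet : ((b : G p) : Matrix (Fin 2) (Fin 2) (F p)).det = 1 := (b : G p).2
    have h10 : ((b : G p) : Matrix (Fin 2) (Fin 2) (F p)) 1 0 = 0 := b.2
    rw [Matrix.det_fin_two, h10, mul_zero, sub_zero] at hdet
    rw [mul_comm]; exact hdet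

variable (k : Type) [Field k] [IsAlgClosed k] [CharZero k]

/-- The group algebra `kG`. -/
abbrev kG : Type := MonoidAlgebra k (G p)

/-- The canonical image of a group element in the group algebra. -/
def γ (g : G p) : kG p k := MonoidAlgebra.of k (G p) g

/-- The submodule of relations defining the induced module
`M(θ) = kG ⊗_{kB} k_θ`, where the character `θ` of `T ≅ Fˣ` is extended to `B`
by letting `U` act trivially. -/
def Nmod (θ : (F p)ˣ →* kˣ) : Submodule (kG p k) (kG p k) :=
  Submodule.span (kG p k)
    {y | ∃ b : B p, y = γ p k (b : G p) - ((θ (Bdiag p b) : k)) • (1 : kG p k)}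

/-- The induced module `M(θ) = kG ⊗_{kB} k_θ`, realized as `kG / N(θ)` where
`N(θ)` is the left submodule generated by the elements `b - θ(b)·1`, `b ∈ B`. -/
def Mmod (θ : (F p)ˣ →* kˣ) : Type := kG p k ⧸ Nmod p k θ

instance (θ : (F p)ˣ →* kˣ) : AddCommGroup (Mmod p k θ) :=
  inferInstanceAs (AddCommGroup (kG p k ⧸ Nmod p k θ))
instance (θ : (F p)ˣ →* kˣ) : Module (kG p k) (Mmod p k θ) :=
  inferInstanceAs (Module (kG p k) (kG p k ⧸ Nmod p k θ))
instance (θ : (F p)ˣ →* kˣ) : Module k (Mmod p k θ) :=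
  inferInstanceAs (Module k (kG p k ⧸ Nmod p k θ))
instance (θ : (F p)ˣ →* kˣ) : IsScalarTower k (kG p k) (Mmod p k θ) :=
  inferInstanceAs (IsScalarTower k (kG p k) (kG p k ⧸ Nmod p k θ))

/-- The canonical generator `1_θ ∈ M(θ)`. -/
def oneθ (θ : (F p)ˣ →* kˣ) : Mmod p k θ :=
  Submodule.Quotient.mk (1 : kG p k)

/-- `η = (1 - s)·1_tr ∈ M(tr)`. -/
def eta : Mmod p k 1 :=
  Submodule.Quotient.mk ((1 : kG p k) - γ p k (sG p))

/-- The Steinberg module `St = kG·η ⊆ M(tr)`. -/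
def St : Submodule (kG p k) (Mmod p k 1) :=
  Submodule.span (kG p k) {eta p k}

/-- `ε(x)·η` as an element of `St`. -/
def E (x : F p) : ↥(St p k) :=
  ⟨γ p k (eps p x) • eta p k,
    Submodule.smul_mem _ _ (Submodule.mem_span_singleton_self _)⟩

/-- The action of a group element on `St`, as a `k`-linear map. -/
def gSt (g : G p) : ↥(St p k) →ₗ[k] ↥(St p k) where
  toFun v := ⟨γ p k g • (v : Mmod p k 1), Submodule.smul_mem _ _ v.2⟩
  map_add' := by intro a b; apply Subtype.ext; simp [smul_add]
  map_smul' := by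
    intro c v; apply Subtype.ext
    simp [smul_comm (γ p k g) c]

/-- `St ⊗_k St`. -/
abbrev StT : Type := ↥(St p k) ⊗[k] ↥(St p k)

/-- The diagonal action of a group element on `St ⊗_k St`. -/
def gTT (g : G p) : StT p k →ₗ[k] StT p k :=
  TensorProduct.map (gSt p k g) (gSt p k g)

/-- `ω_{x,y} = (ε(x)η ⊗ ε(y)η + ε(y)η ⊗ ε(x)η)/2`. -/
def ω (x y : F p) : StT p k :=
  (2 : k)⁻¹ • (E p k x ⊗ₜ[k] E p k y + E p k y ⊗ₜ[k] E p k x)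

/-- `ρ_{x,y} = (ε(x)η ⊗ ε(y)η − ε(y)η ⊗ ε(x)η)/2`. -/
def ρ (x y : F p) : StT p k :=
  (2 : k)⁻¹ • (E p k x ⊗ₜ[k] E p k y - E p k y ⊗ₜ[k] E p k x)

/-- `V₊`, the span of the `ω_{x,y}`. -/
def Vplus : Submodule k (StT p k) :=
  Submodule.span k {v | ∃ x y : F p, v = ω p k x y}

/-- `V₋`, the span of the `ρ_{x,y}` for `x ≠ y`. -/
def Vminus : Submodule k (StT p k) :=
  Submodule.span k {v | ∃ x y : F p, x ≠ y ∧ v = ρ p k x y}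


/-- The relations defining the module `kG ⊗_{kT} k_θ` induced from the torus. -/
def NT (θ : (F p)ˣ →* kˣ) : Submodule (kG p k) (kG p k) :=
  Submodule.span (kG p k)
    {y | ∃ t : (F p)ˣ, y = γ p k (h p t) - ((θ t : k)) • (1 : kG p k)}

/-- The induced module `kG ⊗_{kT} k_θ`, realized as `kG / N_T(θ)`. -/
def MT (θ : (F p)ˣ →* kˣ) : Type := kG p k ⧸ NT p k θ

instance (θ : (F p)ˣ →* kˣ) : AddCommGroup (MT p k θ) :=
  inferInstanceAs (AddCommGroup (kG p k ⧸ NT p k θ))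
instance (θ : (F p)ˣ →* kˣ) : Module (kG p k) (MT p k θ) :=
  inferInstanceAs (Module (kG p k) (kG p k ⧸ NT p k θ))
instance (θ : (F p)ˣ →* kˣ) : Module k (MT p k θ) :=
  inferInstanceAs (Module k (kG p k ⧸ NT p k θ))
instance (θ : (F p)ˣ →* kˣ) : IsScalarTower k (kG p k) (MT p k θ) :=
  inferInstanceAs (IsScalarTower k (kG p k) (kG p k ⧸ NT p k θ))

/-- The action of a group element on `M(θ)`, as a `k`-linear map. -/
def gM (θ : (F p)ˣ →* kˣ) (g : G p) : Mmod p k θ →ₗ[k] Mmod p k θ where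
  toFun m := γ p k g • m
  map_add' := by intro a b; simp [smul_add]
  map_smul' := by intro c m; simp [smul_comm (γ p k g) c]

set_option linter.unusedSectionVars false

/-- A `k`-linear map on `kG` factors through a quotient of `kG`
by a left ideal as soon as it kills all translates of the generators of the ideal. -/
lemma exists_linearMap_quotient_span {V : Type*} [AddCommGroup V] [Module k V]
    (S : Set (kG p k)) (L : kG p k →ₗ[k] V) (hL : ∀ g, ∀ y ∈ S, L (γ p k g * y) = 0) :
    ∃ L' : (kG p k ⧸ Submodule.span (kG p k) S) →ₗ[k] V,
      ∀ a, L' (Submodule.Quotient.mk a) = L a := by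
  have key : ∀ y ∈ Submodule.span (kG p k) S, ∀ a, L (a * y) = 0 := by
    intro y hy
    induction hy using Submodule.span_induction with
    | mem y hy =>
      intro a
      induction a using MonoidAlgebra.induction_on with
      | of g => exact hL g y hy
      | add a b ha hb => rw [add_mul, map_add, ha, hb, add_zero]
      | smul r a ha => rw [smul_mul_assoc, map_smul, ha, smul_zero]
    | zero => simp
    | add x y _ _ hx hy => intro a; rw [mul_add, map_add, hx, hy, add_zero]
    | smul b x _ hx => intro a; rw [smul_eq_mul, ← mul_assoc, hx]
  refine ⟨(((Submodule.span (kG p k) S).restrictScalars k).liftQ L ?_).comp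
    (Submodule.Quotient.restrictScalarsEquiv k _).symm.toLinearMap, fun a => rfl⟩
  intro y hy
  simpa using key y hy 1

lemma γ_mul (g g' : G p) : γ p k (g * g') = γ p k g * γ p k g' :=
  map_mul (MonoidAlgebra.of k (G p)) g g'

lemma γ_one : γ p k 1 = 1 := map_one (MonoidAlgebra.of k (G p))

/-- The linear extension to `kG` of a function on `G`. -/
def extend {V : Type*} [AddCommGroup V] [Module k V] (f : G p → V) : kG p k →ₗ[k] V :=
  (MonoidAlgebra.basis (G p) k).constr k f

lemma extend_γ {V : Type*} [AddCommGroup V] [Module k V] (f : G p → V) (g : G p) :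
    extend p k f (γ p k g) = f g := by
  have := (MonoidAlgebra.basis (G p) k).constr_basis k f g
  simpa [extend, γ] using this

/-- The canonical generator of `kG ⊗_{kT} k_θ`. -/
def oneT (θ : (F p)ˣ →* kˣ) : MT p k θ :=
  Submodule.Quotient.mk (1 : kG p k)

variable {p k}

lemma mk_eq_smul_oneθ (θ : (F p)ˣ →* kˣ) (a : kG p k) :
    (Submodule.Quotient.mk a : kG p k ⧸ Nmod p k θ) = a • oneθ p k θ :=
  congrArg Submodule.Quotient.mk (mul_one a).symm

lemma mk_eq_smul_oneT (θ : (F p)ˣ →* kˣ) (a : kG p k) :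
    (Submodule.Quotient.mk a : kG p k ⧸ NT p k θ) = a • oneT p k θ :=
  congrArg Submodule.Quotient.mk (mul_one a).symm

lemma γ_smul_oneθ (θ : (F p)ˣ →* kˣ) (b : B p) :
    γ p k (b : G p) • oneθ p k θ = (θ (Bdiag p b) : k) • oneθ p k θ := by
  have hb : γ p k (b : G p) - (θ (Bdiag p b) : k) • (1 : kG p k) ∈ Nmod p k θ :=
    Submodule.subset_span ⟨b, rfl⟩
  rw [← mk_eq_smul_oneθ]
  exact (Submodule.Quotient.eq _).2 hb

lemma γ_h_smul_oneT (θ : (F p)ˣ →* kˣ) (t : (F p)ˣ) :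
    γ p k (h p t) • oneT p k θ = (θ t : k) • oneT p k θ := by
  have ht : γ p k (h p t) - (θ t : k) • (1 : kG p k) ∈ NT p k θ :=
    Submodule.subset_span ⟨t, rfl⟩
  rw [← mk_eq_smul_oneT]
  exact (Submodule.Quotient.eq _).2 ht

lemma exists_linearMap_Mmod {V : Type*} [AddCommGroup V] [Module k V] (θ : (F p)ˣ →* kˣ)
    (f : G p → V) (hf : ∀ g (b : B p), f (g * b) = (θ (Bdiag p b) : k) • f g) :
    ∃ L : Mmod p k θ →ₗ[k] V, ∀ g, L (γ p k g • oneθ p k θ) = f g := by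
  obtain ⟨L, hL⟩ := exists_linearMap_quotient_span p k
    {y | ∃ b : B p, y = γ p k (b : G p) - ((θ (Bdiag p b) : k)) • (1 : kG p k)}
    (extend p k f) (by
      rintro g _ ⟨b, rfl⟩
      rw [mul_sub, ← γ_mul, mul_smul_comm, mul_one, map_sub, map_smul, extend_γ, extend_γ, hf,
        sub_self])
  refine ⟨L, fun g => ?_⟩
  rw [← mk_eq_smul_oneθ, ← extend_γ p k f g]
  exact hL _

lemma exists_linearMap_MT {V : Type*} [AddCommGroup V] [Module k V] (θ : (F p)ˣ →* kˣ)
    (f : G p → V) (hf : ∀ g t, f (g * h p t) = (θ t : k) • f g) :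
    ∃ L : MT p k θ →ₗ[k] V, ∀ g, L (γ p k g • oneT p k θ) = f g := by
  obtain ⟨L, hL⟩ := exists_linearMap_quotient_span p k
    {y | ∃ t : (F p)ˣ, y = γ p k (h p t) - ((θ t : k)) • (1 : kG p k)}
    (extend p k f) (by
      rintro g _ ⟨t, rfl⟩
      rw [mul_sub, ← γ_mul, mul_smul_comm, mul_one, map_sub, map_smul, extend_γ, extend_γ, hf,
        sub_self])
  refine ⟨L, fun g => ?_⟩
  rw [← mk_eq_smul_oneT, ← extend_γ p k f g]
  exact hL _

lemma Mmod_induction (θ : (F p)ˣ →* kˣ) (W : Submodule k (Mmod p k θ))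
    (hW : ∀ g, γ p k g • oneθ p k θ ∈ W) (m : Mmod p k θ) : m ∈ W := by
  obtain ⟨a, rfl⟩ := Submodule.Quotient.mk_surjective (Nmod p k θ) m
  rw [mk_eq_smul_oneθ]
  induction a using MonoidAlgebra.induction_on with
  | of g => exact hW g
  | add a b ha hb => rw [add_smul]; exact W.add_mem ha hb
  | smul r a ha => rw [smul_assoc]; exact W.smul_mem r ha

lemma MT_induction (θ : (F p)ˣ →* kˣ) (W : Submodule k (MT p k θ))
    (hW : ∀ g, γ p k g • oneT p k θ ∈ W) (m : MT p k θ) : m ∈ W := by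
  obtain ⟨a, rfl⟩ := Submodule.Quotient.mk_surjective (NT p k θ) m
  rw [mk_eq_smul_oneT]
  induction a using MonoidAlgebra.induction_on with
  | of g => exact hW g
  | add a b ha hb => rw [add_smul]; exact W.add_mem ha hb
  | smul r a ha => rw [smul_assoc]; exact W.smul_mem r ha

lemma Mmod_hom_ext {V : Type*} [AddCommMonoid V] [Module k V] {θ : (F p)ˣ →* kˣ}
    {L L' : Mmod p k θ →ₗ[k] V}
    (hL : ∀ g, L (γ p k g • oneθ p k θ) = L' (γ p k g • oneθ p k θ)) : L = L' :=
  LinearMap.ext fun m => Mmod_induction θ (LinearMap.eqLocus L L') hL m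

lemma MT_hom_ext {V : Type*} [AddCommMonoid V] [Module k V] {θ : (F p)ˣ →* kˣ}
    {L L' : MT p k θ →ₗ[k] V}
    (hL : ∀ g, L (γ p k g • oneT p k θ) = L' (γ p k g • oneT p k θ)) : L = L' :=
  LinearMap.ext fun m => MT_induction θ (LinearMap.eqLocus L L') hL m

/-- The action of a group element on `kG ⊗_{kT} k_θ`, as a `k`-linear map. -/
def gMT (θ : (F p)ˣ →* kˣ) (g : G p) : MT p k θ →ₗ[k] MT p k θ where
  toFun m := γ p k g • m
  map_add' := by intro a b; simp [smul_add]
  map_smul' := by intro c m; simp [smul_comm (γ p k g) c]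

lemma γ_smul_smul {M : Type*} [AddCommGroup M] [Module (kG p k) M] (g g' : G p) (m : M) :
    γ p k g • γ p k g' • m = γ p k (g * g') • m := by
  rw [γ_mul, mul_smul]

lemma eta_eq : eta p k = oneθ p k 1 - γ p k (sG p) • oneθ p k 1 := by
  rw [← mk_eq_smul_oneθ]; rfl

lemma γ_smul_oneθ_one (b : B p) : γ p k (b : G p) • oneθ p k 1 = oneθ p k 1 := by
  simpa using γ_smul_oneθ (1 : (F p)ˣ →* kˣ) b

lemma eps_mem_B (x : F p) : eps p x ∈ B p := by
  change (eps p x : Matrix (Fin 2) (Fin 2) (F p)) 1 0 = 0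
  simp [eps]

lemma h_mem_B (t : (F p)ˣ) : h p t ∈ B p := by
  change (h p t : Matrix (Fin 2) (Fin 2) (F p)) 1 0 = 0
  simp [h]

lemma γ_eps_smul_oneθ (θ : (F p)ˣ →* kˣ) (x : F p) :
    γ p k (eps p x) • oneθ p k θ = oneθ p k θ := by
  have hd : Bdiag p ⟨eps p x, eps_mem_B x⟩ = 1 := by
    ext; simp [Bdiag, eps]
  simpa [hd] using γ_smul_oneθ θ ⟨eps p x, eps_mem_B x⟩

lemma γ_h_smul_oneθ (θ : (F p)ˣ →* kˣ) (t : (F p)ˣ) :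
    γ p k (h p t) • oneθ p k θ = (θ t : k) • oneθ p k θ := by
  have hd : Bdiag p ⟨h p t, h_mem_B t⟩ = t := by
    ext; simp [Bdiag, h]
  simpa [hd] using γ_smul_oneθ θ ⟨h p t, h_mem_B t⟩

lemma h_mul_sG (t : (F p)ˣ) : h p t * sG p = sG p * h p t⁻¹ := by
  apply Subtype.ext
  rw [Matrix.SpecialLinearGroup.coe_mul, Matrix.SpecialLinearGroup.coe_mul]
  simp [h, sG]

lemma γ_h_smul_eta (t : (F p)ˣ) : γ p k (h p t) • eta p k = eta p k := by
  rw [eta_eq, smul_sub, γ_smul_smul, h_mul_sG, ← γ_smul_smul, γ_h_smul_oneθ, γ_h_smul_oneθ]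
  simp

lemma eps_zero : eps p 0 = 1 := by
  ext i j
  fin_cases i <;> fin_cases j <;> simp [eps]

/-- Bruhat decomposition: the elements outside of `B` are in the big cell `U s B`. -/
lemma exists_eq_eps_mul_sG_mul (g : G p) (hg : g 1 0 ≠ 0) :
    ∃ b : B p, g = eps p (g 0 0 / g 1 0) * sG p * b := by
  refine ⟨⟨(eps p (g 0 0 / g 1 0) * sG p)⁻¹ * g, ?_⟩, by group⟩
  change (((eps p (g 0 0 / g 1 0) * sG p)⁻¹ * g : G p) : Matrix (Fin 2) (Fin 2) (F p)) 1 0 = 0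
  rw [Matrix.SpecialLinearGroup.coe_mul, Matrix.SpecialLinearGroup.coe_inv,
    Matrix.SpecialLinearGroup.coe_mul]
  simp [Matrix.adjugate_fin_two, Matrix.mul_apply, Fin.sum_univ_two, eps, sG]
  field_simp
  ring

lemma γ_smul_oneθ_sub_mem (g : G p) :
    γ p k g • oneθ p k 1 - oneθ p k 1 ∈
      Submodule.span k (Set.range fun x => γ p k (eps p x) • eta p k) := by
  by_cases hg : g 1 0 = 0
  · rw [γ_smul_oneθ_one ⟨g, hg⟩, sub_self]
    exact Submodule.zero_mem _
  · obtain ⟨b, hb⟩ := exists_eq_eps_mul_sG_mul g hg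
    have : γ p k g • oneθ p k 1 - oneθ p k 1 =
        -(γ p k (eps p (g 0 0 / g 1 0)) • eta p k) := by
      rw [eta_eq, smul_sub, γ_eps_smul_oneθ, neg_sub]
      conv_lhs => rw [hb, ← γ_smul_smul, γ_smul_oneθ_one, ← γ_smul_smul]
    rw [this]
    exact Submodule.neg_mem _ (Submodule.subset_span ⟨_, rfl⟩)

/-- The elements `ε(x)η` span the Steinberg module over `k`. -/
lemma span_range_E : Submodule.span k (Set.range (E p k)) = ⊤ := by
  set W := Submodule.span k (Set.range fun x => γ p k (eps p x) • eta p k) with hW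
  have key : ∀ a : kG p k, a • eta p k ∈ W := by
    intro a
    induction a using MonoidAlgebra.induction_on with
    | of g =>
      change γ p k g • eta p k ∈ W
      have := W.sub_mem (γ_smul_oneθ_sub_mem g) (γ_smul_oneθ_sub_mem (g * sG p))
      rwa [sub_sub_sub_cancel_right, ← γ_smul_smul, ← smul_sub, ← eta_eq] at this
    | add a b ha hb => rw [add_smul]; exact W.add_mem ha hb
    | smul r a ha => rw [smul_assoc]; exact W.smul_mem r ha
  let ι : ↥(St p k) →ₗ[k] Mmod p k 1 := (St p k).subtype.restrictScalars k
  have hι : Function.Injective ι := Subtype.val_injective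
  have hmap : (Submodule.span k (Set.range (E p k))).map ι = W := by
    rw [Submodule.map_span, ← Set.range_comp]; rfl
  rw [eq_top_iff]
  rintro v -
  obtain ⟨a, ha⟩ := Submodule.mem_span_singleton.1 v.2
  have hv : ι v ∈ (Submodule.span k (Set.range (E p k))).map ι := by
    rw [hmap]
    change (v : Mmod p k 1) ∈ W
    rw [← ha]
    exact key a
  obtain ⟨w, hw, hwv⟩ := hv
  rwa [← hι hwv]

lemma B_mul_eps (b : B p) (x : F p) :
    (b : G p) * eps p x =
      eps p ((b : G p) 0 0 * ((b : G p) 0 0 * x + (b : G p) 0 1)) * h p (Bdiag p b) := by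
  have h10 : (b : G p) 1 0 = 0 := b.2
  have hinv : (b : G p) 0 0 * (b : G p) 1 1 = 1 := (Bdiag p b).val_inv
  apply Subtype.ext
  rw [Matrix.SpecialLinearGroup.coe_mul, Matrix.SpecialLinearGroup.coe_mul]
  ext i j
  fin_cases i <;> fin_cases j <;>
    simp [h, eps, Bdiag, Matrix.mul_apply, Fin.sum_univ_two, h10]
  linear_combination (-((b : G p) 0 0 * x + (b : G p) 0 1)) * hinv

/-- There is a `B`-semiequivariant linear map `M(tr) → kG ⊗_{kT} k_θ` sending `η` to `1_θ`. -/
lemma exists_semiequivariant (θ : (F p)ˣ →* kˣ) :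
    ∃ φ : Mmod p k 1 →ₗ[k] MT p k θ, φ (eta p k) = oneT p k θ ∧
      ∀ (b : B p) m, (θ (Bdiag p b) : k) • φ (γ p k (b : G p) • m) = γ p k (b : G p) • φ m := by
  classical
  obtain ⟨φ, hφ⟩ := exists_linearMap_Mmod (1 : (F p)ˣ →* kˣ)
    (fun g => if g 1 0 = 0 then 0 else -(γ p k (eps p (g 0 0 / g 1 0)) • oneT p k θ)) (by
      intro g b
      have h10 : (b : G p) 1 0 = 0 := b.2
      have h00 : (b : G p) 0 0 ≠ 0 := (Bdiag p b).ne_zero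
      simp [Matrix.mul_apply, Fin.sum_univ_two, h10, h00, mul_div_mul_right])
  refine ⟨φ, ?_, fun b => ?_⟩
  · have h1 := hφ 1
    rw [γ_one, one_smul] at h1
    rw [eta_eq, map_sub, hφ, h1]
    simp [sG, eps_zero, γ_one]
  · suffices hs : (θ (Bdiag p b) : k) • φ ∘ₗ gM p k 1 b = gMT θ b ∘ₗ φ from
      fun m => LinearMap.congr_fun hs m
    refine Mmod_hom_ext fun g => ?_
    change (θ (Bdiag p b) : k) • φ (γ p k (b : G p) • γ p k g • oneθ p k 1) =
      γ p k (b : G p) • φ (γ p k g • oneθ p k 1)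
    rw [γ_smul_smul, hφ, hφ]
    have h10 : (b : G p) 1 0 = 0 := b.2
    have hinv : (b : G p) 0 0 * (b : G p) 1 1 = 1 := (Bdiag p b).val_inv
    have h11 : (b : G p) 1 1 ≠ 0 := right_ne_zero_of_mul_eq_one hinv
    have e10 : ((b : G p) * g) 1 0 = (b : G p) 1 1 * g 1 0 := by
      simp [Matrix.mul_apply, Fin.sum_univ_two, h10]
    have e00 : ((b : G p) * g) 0 0 = (b : G p) 0 0 * g 0 0 + (b : G p) 0 1 * g 1 0 := by
      simp [Matrix.mul_apply, Fin.sum_univ_two]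
    by_cases hg : g 1 0 = 0
    · simp [e10, hg]
    · rw [if_neg hg, if_neg (by rw [e10]; exact mul_ne_zero h11 hg), smul_neg, smul_neg,
        γ_smul_smul, B_mul_eps, ← γ_smul_smul, γ_h_smul_oneT, smul_comm (γ p k _)]
      congr 5
      rw [e00, e10, div_eq_iff (mul_ne_zero h11 hg)]
      field_simp
      linear_combination (-((b : G p) 0 0 * g 0 0 + (b : G p) 0 1 * g 1 0)) * hinv

lemma map_gSt_gM_mul (θ : (F p)ˣ →* kˣ) (g g' : G p) (v : ↥(St p k) ⊗[k] Mmod p k θ) :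
    TensorProduct.map (gSt p k (g * g')) (gM p k θ (g * g')) v =
      TensorProduct.map (gSt p k g) (gM p k θ g)
        (TensorProduct.map (gSt p k g') (gM p k θ g') v) := by
  have h1 : gSt p k (g * g') = gSt p k g ∘ₗ gSt p k g' :=
    LinearMap.ext fun v => Subtype.ext (γ_smul_smul g g' (v : Mmod p k 1)).symm
  have h2 : gM p k θ (g * g') = gM p k θ g ∘ₗ gM p k θ g' :=
    LinearMap.ext fun v => (γ_smul_smul g g' v).symm
  rw [h1, h2, TensorProduct.map_comp, LinearMap.comp_apply]

lemma gSt_E (x : F p) : gSt p k (eps p x) (E p k 0) = E p k x := by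
  apply Subtype.ext
  change γ p k (eps p x) • γ p k (eps p 0) • eta p k = γ p k (eps p x) • eta p k
  rw [eps_zero, γ_one, one_smul]

/-- `η ⊗ 1_θ` generates `St ⊗ M(θ)`. -/
lemma eq_top_of_invariant (θ : (F p)ˣ →* kˣ) (R : Submodule k (↥(St p k) ⊗[k] Mmod p k θ))
    (hR : ∀ g, ∀ v ∈ R, TensorProduct.map (gSt p k g) (gM p k θ g) v ∈ R)
    (h0 : E p k 0 ⊗ₜ[k] oneθ p k θ ∈ R) : R = ⊤ := by
  have hone : ∀ v : ↥(St p k), v ⊗ₜ[k] oneθ p k θ ∈ R := by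
    intro v
    have hv : v ∈ Submodule.span k (Set.range (E p k)) := by rw [span_range_E]; trivial
    induction hv using Submodule.span_induction with
    | mem v hv =>
      obtain ⟨x, rfl⟩ := hv
      have := hR (eps p x) _ h0
      rw [TensorProduct.map_tmul, gSt_E] at this
      rwa [show gM p k θ (eps p x) (oneθ p k θ) = oneθ p k θ from γ_eps_smul_oneθ θ x] at this
    | zero => simp
    | add v w _ _ hv hw => rw [TensorProduct.add_tmul]; exact R.add_mem hv hw
    | smul r v _ hv => rw [← TensorProduct.smul_tmul']; exact R.smul_mem r hv
  rw [eq_top_iff, ← TensorProduct.span_tmul_eq_top, Submodule.span_le]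
  rintro _ ⟨v, m, rfl⟩
  refine Mmod_induction θ (R.comap (TensorProduct.mk k _ _ v)) (fun g => ?_) m
  have := hR g _ (hone (gSt p k g⁻¹ v))
  rw [TensorProduct.map_tmul] at this
  have hv : gSt p k g (gSt p k g⁻¹ v) = v := by
    apply Subtype.ext
    change γ p k g • γ p k g⁻¹ • (v : Mmod p k 1) = v
    rw [γ_smul_smul, mul_inv_cancel, γ_one, one_smul]
  rwa [hv] at this

variable (p k)

/-- `St ⊗_k M(θ) ≅ kG ⊗_{kT} k_θ` as `kG`-modules, the left-hand
side carrying the diagonal `G`-action. -/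
theorem stmt18 (hp2 : p ≠ 2) (θ : (F p)ˣ →* kˣ) :
    ∃ e : (↥(St p k) ⊗[k] Mmod p k θ) ≃ₗ[k] MT p k θ,
      ∀ (g : G p) (v : ↥(St p k) ⊗[k] Mmod p k θ),
        e (TensorProduct.map (gSt p k g) (gM p k θ g) v) = γ p k g • e v := by
  obtain ⟨f, hf⟩ := exists_linearMap_MT θ
    (fun g => TensorProduct.map (gSt p k g) (gM p k θ g) (E p k 0 ⊗ₜ[k] oneθ p k θ)) (by
      intro g t
      have hE : gSt p k (h p t) (E p k 0) = E p k 0 := by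
        apply Subtype.ext
        change γ p k (h p t) • γ p k (eps p 0) • eta p k = γ p k (eps p 0) • eta p k
        rw [eps_zero, γ_one, one_smul, γ_h_smul_eta]
      have h1 : gM p k θ (h p t) (oneθ p k θ) = (θ t : k) • oneθ p k θ := γ_h_smul_oneθ θ t
      rw [map_gSt_gM_mul, TensorProduct.map_tmul, hE, h1, TensorProduct.tmul_smul, map_smul])
  have hequiv : ∀ g m, f (γ p k g • m) = TensorProduct.map (gSt p k g) (gM p k θ g) (f m) := by
    intro g
    suffices hs : f ∘ₗ gMT θ g = TensorProduct.map (gSt p k g) (gM p k θ g) ∘ₗ f from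
      fun m => LinearMap.congr_fun hs m
    refine MT_hom_ext fun g' => ?_
    change f (γ p k g • γ p k g' • oneT p k θ) =
      TensorProduct.map (gSt p k g) (gM p k θ g) (f (γ p k g' • oneT p k θ))
    rw [γ_smul_smul, hf, hf, map_gSt_gM_mul]
  have hone : f (oneT p k θ) = E p k 0 ⊗ₜ[k] oneθ p k θ := by
    have := hf (eps p 0)
    rwa [TensorProduct.map_tmul, gSt_E,
      show gM p k θ (eps p 0) (oneθ p k θ) = oneθ p k θ from γ_eps_smul_oneθ θ 0,
      eps_zero, γ_one, one_smul] at this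
  have hsurj : Function.Surjective f := by
    rw [← LinearMap.range_eq_top]
    refine eq_top_of_invariant θ _ ?_ ⟨_, hone⟩
    rintro g _ ⟨m, rfl⟩
    exact ⟨_, hequiv g m⟩
  obtain ⟨φ, hφη, hφ⟩ := exists_semiequivariant (k := k) θ
  obtain ⟨Φ, hΦ⟩ := exists_linearMap_Mmod θ
    (fun g => gMT θ g ∘ₗ φ ∘ₗ gM p k 1 g⁻¹) (by
      intro g b
      ext m
      change γ p k (g * b) • φ (γ p k (g * b)⁻¹ • m) =
        (θ (Bdiag p b) : k) • γ p k g • φ (γ p k g⁻¹ • m)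
      rw [← γ_smul_smul, ← hφ, γ_smul_smul, mul_inv_rev, mul_inv_cancel_left, smul_comm])
  let Ψ : ↥(St p k) ⊗[k] Mmod p k θ →ₗ[k] MT p k θ :=
    TensorProduct.lift (Φ.flip ∘ₗ (St p k).subtype.restrictScalars k)
  have hΨ : Ψ ∘ₗ f = LinearMap.id := by
    refine MT_hom_ext fun g => ?_
    change Ψ (f _) = γ p k g • oneT p k θ
    rw [hf, TensorProduct.map_tmul]
    change Φ (γ p k g • oneθ p k θ) (γ p k g • γ p k (eps p 0) • eta p k) = _
    rw [hΦ]
    change γ p k g • φ (γ p k g⁻¹ • γ p k g • γ p k (eps p 0) • eta p k) = _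
    rw [γ_smul_smul, inv_mul_cancel, eps_zero, γ_one, one_smul, one_smul, hφη]
  have hinj : Function.Injective f :=
    Function.LeftInverse.injective (g := Ψ) fun m => LinearMap.congr_fun hΨ m
  let e := LinearEquiv.ofBijective f ⟨hinj, hsurj⟩
  refine ⟨e.symm, fun g v => ?_⟩
  rw [LinearEquiv.symm_apply_eq]
  change _ = f _
  rw [hequiv]
  congr 1
  exact (e.apply_symm_apply v).symm

end SL2X
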